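/- (Almost-sure convergence of the empirical matrices.) Let (X_t)_{t≥0} be the canonical stationary BAR(1) chain with parameters (ρ, p), let (ρ̂_n, p̂_n) be the CLS estimators computed from X_0,…,X_n, s_t(θ̂_n) = X_t − ρ̂_n X_{t−1} − N p̂_n(1−ρ̂_n), and define V̂_n and Ŵ_n by V̂_n^{(1,1)} = (1/n) Σ_{t=1}^n (X_{t−1} − N p̂_n)², V̂_n^{(1,2)} = V̂_n^{(2,1)} = (1/n) Σ_{t=1}^n (X_{t−1} − N p̂_n) N(1−ρ̂_n), V̂_n^{(2,2)} = N²(1−ρ̂_n)², Ŵ_n^{(1,1)} = (1/n) Σ_{t=1}^n [s_t(θ̂_n)(X_{t−1} − N p̂_n)]², Ŵ_n^{(1,2)} = Ŵ_n^{(2,1)} = (1/n) Σ_{t=1}^n s_t(θ̂_n)² (X_{t−1} − N p̂_n) N(1−ρ̂_n), Ŵ_n^{(2,2)} = (1/n) Σ_{t=1}^n [s_t(θ̂_n) N(1−ρ̂_n)]². Then μ-almost surely, as n → ∞, V̂_n converges entrywise to the matrix with entries (N p(1−p), 0; 0, N²(1−ρ)²) and Ŵ_n converges entrywise to W_CLS.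 -/

import Mathlib

open MeasureTheory Filter Finset Matrix

noncomputable section

/-- BAR(1) one-step transition probability `K(i,{j})` with parameters `(ρ, p)`,
where `β = p(1-ρ)` and `α = β + ρ`. -/
def barK (N : ℕ) (ρ p : ℝ) (i j : ℕ) : ℝ :=
  ∑ k ∈ Finset.Icc (i + j - N) (min i j),
    (Nat.choose i k : ℝ) * (Nat.choose (N - i) (j - k)) *
      (p * (1 - ρ) + ρ) ^ k * (1 - (p * (1 - ρ) + ρ)) ^ (i - k) *
      (p * (1 - ρ)) ^ (j - k) * (1 - p * (1 - ρ)) ^ (N + k - (i + j))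

/-- Binomial(N,p) probability mass function. -/
def binomPMF (N : ℕ) (p : ℝ) (i : ℕ) : ℝ :=
  (Nat.choose N i : ℝ) * p ^ i * (1 - p) ^ (N - i)

/-- CLS estimator of ρ from observations `x 0, …, x n`. -/
def clsRho (x : ℕ → ℝ) (n : ℕ) : ℝ :=
  ((n : ℝ) * ∑ t ∈ Finset.Icc 1 n, x t * x (t - 1)
      - (∑ t ∈ Finset.Icc 1 n, x t) * (∑ t ∈ Finset.Icc 1 n, x (t - 1))) /
    ((n : ℝ) * ∑ t ∈ Finset.Icc 1 n, (x (t - 1)) ^ 2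
      - (∑ t ∈ Finset.Icc 1 n, x (t - 1)) ^ 2)

/-- CLS estimator of p from observations `x 0, …, x n`. -/
def clsP (N : ℕ) (x : ℕ → ℝ) (n : ℕ) : ℝ :=
  ((∑ t ∈ Finset.Icc 1 n, x t) - clsRho x n * ∑ t ∈ Finset.Icc 1 n, x (t - 1)) /
    ((n : ℝ) * N * (1 - clsRho x n))

/-- The real-valued observation sequence attached to a trajectory `ω`. -/
def xR (ω : ℕ → ℕ) (t : ℕ) : ℝ := (ω t : ℝ)

/-- Conditional variance σ²(i) of the BAR(1) model. -/
def sigmaSq (N : ℕ) (ρ p : ℝ) (i : ℕ) : ℝ :=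
  ρ * (1 - ρ) * (1 - 2 * p) * i + N * p * (1 - ρ) * (1 - p * (1 - ρ))

/-- The matrix `W_CLS`. -/
def Wcls (N : ℕ) (ρ p : ℝ) : Matrix (Fin 2) (Fin 2) ℝ :=
  !![∑ i ∈ Finset.range (N + 1), binomPMF N p i * ((i : ℝ) - N * p) ^ 2 * sigmaSq N ρ p i,
     (N : ℝ) * (1 - ρ) *
       ∑ i ∈ Finset.range (N + 1), binomPMF N p i * ((i : ℝ) - N * p) * sigmaSq N ρ p i;
     (N : ℝ) * (1 - ρ) *
       ∑ i ∈ Finset.range (N + 1), binomPMF N p i * ((i : ℝ) - N * p) * sigmaSq N ρ p i,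
     (N : ℝ) ^ 2 * (1 - ρ) ^ 2 * ∑ i ∈ Finset.range (N + 1), binomPMF N p i * sigmaSq N ρ p i]

/-- Residual `s_t(ρ, p) = x_t - ρ x_{t-1} - N p (1-ρ)`. -/
def resid (N : ℕ) (ρ p : ℝ) (x : ℕ → ℝ) (t : ℕ) : ℝ :=
  x t - ρ * x (t - 1) - N * p * (1 - ρ)

/-- The empirical matrix `V̂_n`, evaluated at the CLS estimators. -/
def Vhat (N n : ℕ) (x : ℕ → ℝ) : Matrix (Fin 2) (Fin 2) ℝ :=
  !![(1 / (n : ℝ)) * ∑ t ∈ Finset.Icc 1 n, (x (t - 1) - N * clsP N x n) ^ 2,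
     (1 / (n : ℝ)) * ∑ t ∈ Finset.Icc 1 n, (x (t - 1) - N * clsP N x n) * (N * (1 - clsRho x n));
     (1 / (n : ℝ)) * ∑ t ∈ Finset.Icc 1 n, (x (t - 1) - N * clsP N x n) * (N * (1 - clsRho x n)),
     (N : ℝ) ^ 2 * (1 - clsRho x n) ^ 2]

/-- The empirical matrix `Ŵ_n`, evaluated at the CLS estimators. -/
def What (N n : ℕ) (x : ℕ → ℝ) : Matrix (Fin 2) (Fin 2) ℝ :=
  !![(1 / (n : ℝ)) * ∑ t ∈ Finset.Icc 1 n,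
        (resid N (clsRho x n) (clsP N x n) x t * (x (t - 1) - N * clsP N x n)) ^ 2,
     (1 / (n : ℝ)) * ∑ t ∈ Finset.Icc 1 n,
        (resid N (clsRho x n) (clsP N x n) x t) ^ 2 *
          (x (t - 1) - N * clsP N x n) * (N * (1 - clsRho x n));
     (1 / (n : ℝ)) * ∑ t ∈ Finset.Icc 1 n,
        (resid N (clsRho x n) (clsP N x n) x t) ^ 2 *
          (x (t - 1) - N * clsP N x n) * (N * (1 - clsRho x n)),
     (1 / (n : ℝ)) * ∑ t ∈ Finset.Icc 1 n,
        (resid N (clsRho x n) (clsP N x n) x t * (N * (1 - clsRho x n))) ^ 2]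

/-! ### Generating polynomials -/

open Polynomial in
lemma bar_coeff_lin (u v : ℝ) (m k : ℕ) :
    ((C u + C v * X : ℝ[X]) ^ m).coeff k = (Nat.choose m k : ℝ) * v ^ k * u ^ (m - k) := by
  rw [add_comm, add_pow, Polynomial.finsetSum_coeff]
  have h : ∀ b ∈ Finset.range (m + 1),
      ((C v * X : ℝ[X]) ^ b * C u ^ (m - b) * (Nat.choose m b : ℝ[X])).coeff k
        = if k = b then (Nat.choose m b : ℝ) * v ^ b * u ^ (m - b) else 0 := by
    intro b _
    have : ((C v * X : ℝ[X]) ^ b * C u ^ (m - b) * (Nat.choose m b : ℝ[X]))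
        = C ((Nat.choose m b : ℝ) * v ^ b * u ^ (m - b)) * X ^ b := by
      simp only [map_mul, map_pow, mul_pow, map_natCast]; ring
    rw [this, Polynomial.coeff_C_mul_X_pow]
  rw [Finset.sum_congr rfl h, Finset.sum_ite_eq]
  split_ifs with hk
  · rfl
  · have : m < k := by simpa using hk
    rw [Nat.choose_eq_zero_of_lt this]; simp

open Polynomial in
/-- Generating polynomial of the sum of two independent binomials. -/
def barPoly (a b : ℝ) (m n : ℕ) : ℝ[X] :=
  (C (1 - a) + C a * X) ^ m * (C (1 - b) + C b * X) ^ n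

open Polynomial in
lemma barPoly_natDegree (a b : ℝ) (m n : ℕ) : (barPoly a b m n).natDegree < m + n + 1 := by
  have h1 : ∀ a : ℝ, (C (1 - a) + C a * X : ℝ[X]).natDegree ≤ 1 := by
    intro a; rw [add_comm]; exact Polynomial.natDegree_linear_le
  have := Polynomial.natDegree_mul_le_of_le
    (Polynomial.natDegree_pow_le_of_le m (h1 a)) (Polynomial.natDegree_pow_le_of_le n (h1 b))
  unfold barPoly
  omega

lemma bar_poly_mom (P : Polynomial ℝ) (n : ℕ) (h : P.natDegree < n) :
    ∑ j ∈ Finset.range n, P.coeff j = P.eval 1 ∧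
    ∑ j ∈ Finset.range n, P.coeff j * j = P.derivative.eval 1 ∧
    ∑ j ∈ Finset.range n, P.coeff j * (j * (j - 1)) = P.derivative.derivative.eval 1 := by
  refine ⟨?_, ?_, ?_⟩
  · rw [Polynomial.eval_eq_sum_range' h]; simp
  · conv_rhs => rw [P.as_sum_range' n h]
    simp [Polynomial.eval_finsetSum, Polynomial.derivative_monomial, Polynomial.eval_monomial]
  · conv_rhs => rw [P.as_sum_range' n h]
    simp only [Polynomial.derivative_sum, Polynomial.derivative_monomial,
      Polynomial.eval_finsetSum, Polynomial.eval_monomial, one_pow, mul_one]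
    refine Finset.sum_congr rfl fun j _ => ?_
    rcases j with _ | j
    · simp
    · push_cast; simp; ring

lemma bar_natsub (i : ℕ) : (i : ℝ) * ((i - 1 : ℕ) : ℝ) = i * (i - 1) := by
  rcases i with _ | j <;> simp

lemma barPoly_evals (a b : ℝ) (m n : ℕ) :
    (barPoly a b m n).eval 1 = 1 ∧
    (barPoly a b m n).derivative.eval 1 = m * a + n * b ∧
    (barPoly a b m n).derivative.derivative.eval 1
      = m * (m - 1) * a ^ 2 + 2 * (m * n) * a * b + n * (n - 1) * b ^ 2 := by
  refine ⟨?_, ?_, ?_⟩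
  · simp [barPoly]
  · simp [barPoly, Polynomial.derivative_mul, Polynomial.derivative_pow]
  · simp [barPoly, Polynomial.derivative_mul, Polynomial.derivative_pow]
    rw [← bar_natsub m, ← bar_natsub n]
    ring

lemma barPoly_mom (a b : ℝ) (m n L : ℕ) (hL : m + n = L) :
    ∑ j ∈ Finset.range (L + 1), (barPoly a b m n).coeff j = 1 ∧
    ∑ j ∈ Finset.range (L + 1), (barPoly a b m n).coeff j * j = m * a + n * b ∧
    ∑ j ∈ Finset.range (L + 1), (barPoly a b m n).coeff j * (j : ℝ) ^ 2 =
      m * (m - 1) * a ^ 2 + 2 * (m * n) * a * b + n * (n - 1) * b ^ 2 + (m * a + n * b) := by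
  subst hL
  obtain ⟨h0, h1, h2⟩ := bar_poly_mom _ _ (barPoly_natDegree a b m n)
  obtain ⟨e0, e1, e2⟩ := barPoly_evals a b m n
  refine ⟨h0.trans e0, h1.trans e1, ?_⟩
  rw [← e2, ← e1, ← h1, ← h2, ← Finset.sum_add_distrib]
  exact Finset.sum_congr rfl fun j _ => by ring

lemma barK_eq_coeff (N : ℕ) (ρ p : ℝ) (i j : ℕ) (hi : i ≤ N) :
    barK N ρ p i j = (barPoly (p * (1 - ρ) + ρ) (p * (1 - ρ)) i (N - i)).coeff j := by
  unfold barPoly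
  rw [Polynomial.coeff_mul, Finset.Nat.sum_antidiagonal_eq_sum_range_succ
    (f := fun x y => Polynomial.coeff _ x * Polynomial.coeff _ y)]
  simp only [bar_coeff_lin]
  unfold barK
  symm
  have hsub : Finset.Icc (i + j - N) (min i j) ⊆ Finset.range j.succ := by
    intro k hk; simp only [Finset.mem_Icc, Finset.mem_range, le_min_iff] at hk ⊢; omega
  rw [← Finset.sum_subset hsub]
  · refine Finset.sum_congr rfl fun k hk => ?_
    simp only [Finset.mem_Icc, le_min_iff] at hk
    have : N - i - (j - k) = N + k - (i + j) := by omega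
    rw [this]; ring
  · intro k hk hk'
    simp only [Finset.mem_Icc, Finset.mem_range, le_min_iff] at hk hk'
    by_cases h : i < k
    · rw [Nat.choose_eq_zero_of_lt h]; simp
    · have : N - i < j - k := by omega
      rw [Nat.choose_eq_zero_of_lt this]; simp

lemma binom_eq_coeff (N : ℕ) (p : ℝ) (i : ℕ) :
    binomPMF N p i = (barPoly p 0 N 0).coeff i := by
  simp only [barPoly, pow_zero, mul_one, bar_coeff_lin]; rfl

lemma binom_mom (N : ℕ) (p : ℝ) :
    ∑ j ∈ Finset.range (N + 1), binomPMF N p j = 1 ∧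
    ∑ j ∈ Finset.range (N + 1), binomPMF N p j * j = N * p ∧
    ∑ j ∈ Finset.range (N + 1), binomPMF N p j * (j : ℝ) ^ 2 =
      N * p * (1 - p) + (N * p) ^ 2 := by
  simp only [binom_eq_coeff]
  obtain ⟨h0, h1, h2⟩ := barPoly_mom p 0 N 0 N (by simp)
  refine ⟨h0, by rw [h1]; simp, by rw [h2]; push_cast; ring⟩

lemma barK_mom (N : ℕ) (ρ p : ℝ) (i : ℕ) (hi : i ≤ N) :
    ∑ j ∈ Finset.range (N + 1), barK N ρ p i j = 1 ∧
    ∑ j ∈ Finset.range (N + 1), barK N ρ p i j * j = ρ * i + N * p * (1 - ρ) ∧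
    ∑ j ∈ Finset.range (N + 1), barK N ρ p i j * ((j : ℝ) - ρ * i - N * p * (1 - ρ)) ^ 2
      = sigmaSq N ρ p i := by
  obtain ⟨h0, h1, h2⟩ := barPoly_mom (p * (1 - ρ) + ρ) (p * (1 - ρ)) i (N - i) N (by omega)
  simp only [← barK_eq_coeff N ρ p i _ hi] at h0 h1 h2
  rw [Nat.cast_sub hi] at h1 h2
  have h1' : ∑ j ∈ Finset.range (N + 1), barK N ρ p i j * j = ρ * i + N * p * (1 - ρ) := by
    rw [h1]; ring
  refine ⟨h0, h1', ?_⟩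
  have : ∀ j ∈ Finset.range (N + 1),
      barK N ρ p i j * ((j : ℝ) - ρ * i - N * p * (1 - ρ)) ^ 2
      = barK N ρ p i j * (j : ℝ) ^ 2
        - 2 * (ρ * i + N * p * (1 - ρ)) * (barK N ρ p i j * j)
        + (ρ * i + N * p * (1 - ρ)) ^ 2 * barK N ρ p i j := fun j _ => by ring
  rw [Finset.sum_congr rfl this, Finset.sum_add_distrib, Finset.sum_sub_distrib,
    ← Finset.mul_sum, ← Finset.mul_sum, h0, h1', h2]
  unfold sigmaSq
  ring

open Polynomial in
lemma bar_stationary (N : ℕ) (ρ p : ℝ) (j : ℕ) :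
    ∑ i ∈ Finset.range (N + 1), binomPMF N p i * barK N ρ p i j = binomPMF N p j := by
  set A : ℝ[X] := C (1 - (p * (1 - ρ) + ρ)) + C (p * (1 - ρ) + ρ) * X with hA
  set B : ℝ[X] := C (1 - p * (1 - ρ)) + C (p * (1 - ρ)) * X with hB
  have key : (C p * A + C (1 - p) * B) = C (1 - p) + C p * X := by
    simp only [hA, hB, map_sub, map_add, map_mul, map_one]; ring
  have h2 := congrArg (fun P : ℝ[X] => (P ^ N).coeff j) key
  simp only [bar_coeff_lin] at h2
  unfold binomPMF at *
  rw [← h2, add_pow, Polynomial.finsetSum_coeff]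
  refine Finset.sum_congr rfl fun i hi => ?_
  rw [barK_eq_coeff N ρ p i j (by simpa [Nat.lt_succ_iff] using hi)]
  have : ((C p * A) ^ i * (C (1 - p) * B) ^ (N - i) * (Nat.choose N i : ℝ[X]))
      = C ((Nat.choose N i : ℝ) * p ^ i * (1 - p) ^ (N - i)) * (A ^ i * B ^ (N - i)) := by
    simp only [map_mul, map_pow, mul_pow, map_natCast]; ring
  rw [this, Polynomial.coeff_C_mul]
  rfl

lemma bar_params {p ρ : ℝ} (hp0 : 0 < p) (hp1 : p < 1)
    (hρl : max (-(p / (1 - p))) (-((1 - p) / p)) < ρ) (hρu : ρ < 1) :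
    0 < p * (1 - ρ) ∧ 0 < 1 - p * (1 - ρ) ∧ 0 < p * (1 - ρ) + ρ ∧
      0 < 1 - (p * (1 - ρ) + ρ) := by
  obtain ⟨h1, h2⟩ := max_lt_iff.mp hρl
  have hq : 0 < 1 - p := by linarith
  rw [neg_lt, lt_div_iff₀ hq] at h1
  rw [neg_lt, lt_div_iff₀ hp0] at h2
  refine ⟨by nlinarith, by nlinarith, by nlinarith, by nlinarith⟩

lemma barK_nonneg {N : ℕ} {p ρ : ℝ} (h : 0 < p * (1 - ρ) ∧ 0 < 1 - p * (1 - ρ) ∧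
    0 < p * (1 - ρ) + ρ ∧ 0 < 1 - (p * (1 - ρ) + ρ)) (i j : ℕ) : 0 ≤ barK N ρ p i j := by
  obtain ⟨h1, h2, h3, h4⟩ := h
  unfold barK
  refine Finset.sum_nonneg fun k _ => ?_
  have := h1.le; have := h2.le; have := h3.le; have := h4.le
  refine mul_nonneg (mul_nonneg (mul_nonneg (mul_nonneg (mul_nonneg ?_ ?_) ?_) ?_) ?_) ?_ <;>
    positivity

lemma barK_pos {N : ℕ} {p ρ : ℝ} (h : 0 < p * (1 - ρ) ∧ 0 < 1 - p * (1 - ρ) ∧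
    0 < p * (1 - ρ) + ρ ∧ 0 < 1 - (p * (1 - ρ) + ρ)) (i j : ℕ) (hi : i ≤ N) (hj : j ≤ N) :
    0 < barK N ρ p i j := by
  obtain ⟨h1, h2, h3, h4⟩ := h
  unfold barK
  refine Finset.sum_pos (fun k hk => ?_) ⟨i + j - N, ?_⟩
  · simp only [Finset.mem_Icc, le_min_iff] at hk
    have c1 : 0 < Nat.choose i k := Nat.choose_pos (by omega)
    have c2 : 0 < Nat.choose (N - i) (j - k) := Nat.choose_pos (by omega)
    have c1' : (0 : ℝ) < Nat.choose i k := by exact_mod_cast c1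
    have c2' : (0 : ℝ) < Nat.choose (N - i) (j - k) := by exact_mod_cast c2
    refine mul_pos (mul_pos (mul_pos (mul_pos (mul_pos c1' c2') ?_) ?_) ?_) ?_ <;> positivity
  · simp only [Finset.mem_Icc, le_min_iff]; omega

lemma barK_zero {N : ℕ} {p ρ : ℝ} (i j : ℕ) (hi : i ≤ N) (hj : N < j) :
    barK N ρ p i j = 0 := by
  unfold barK
  rw [Finset.Icc_eq_empty, Finset.sum_empty]
  simp only [le_min_iff]; omega

/-! ### One-step property -/

lemma bar_path_zero {N : ℕ} {p ρ : ℝ} (n : ℕ) (x : ℕ → ℕ) (h : N < x n) :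
    binomPMF N p (x 0) * ∏ t ∈ Finset.Icc 1 n, barK N ρ p (x (t - 1)) (x t) = 0 := by
  induction n with
  | zero => simp [binomPMF, Nat.choose_eq_zero_of_lt h]
  | succ n ih =>
    rw [Finset.prod_Icc_succ_top (by omega), ← mul_assoc]
    by_cases hn : N < x n
    · rw [ih hn, zero_mul]
    · rw [Nat.add_sub_cancel, barK_zero _ _ (by omega) h, mul_zero]

section markov
variable {N : ℕ} {p ρ : ℝ} {μ : Measure (ℕ → ℕ)}

lemma bar_cyl_step [IsProbabilityMeasure μ]
    (hK : ∀ i j, 0 ≤ barK N ρ p i j)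
    (hμ : ∀ (n : ℕ) (x : ℕ → ℕ),
      μ {ω | ∀ t ≤ n, ω t = x t} =
        ENNReal.ofReal (binomPMF N p (x 0) *
          ∏ t ∈ Finset.Icc 1 n, barK N ρ p (x (t - 1)) (x t)))
    (n : ℕ) (x : ℕ → ℕ) (j : ℕ) :
    μ ({ω | ω (n + 1) = j} ∩ {ω | ∀ t ≤ n, ω t = x t}) =
      ENNReal.ofReal (barK N ρ p (x n) j) * μ {ω | ∀ t ≤ n, ω t = x t} := by
  have hset : ({ω | ω (n + 1) = j} ∩ {ω | ∀ t ≤ n, ω t = x t} : Set (ℕ → ℕ))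
      = {ω | ∀ t ≤ n + 1, ω t = Function.update x (n + 1) j t} := by
    ext ω
    simp only [Set.mem_inter_iff, Set.mem_ofPred_eq]
    constructor
    · rintro ⟨h1, h2⟩ t ht
      rcases Nat.lt_or_ge n t with h | h
      · obtain rfl : t = n + 1 := by omega
        simpa using h1
      · rw [Function.update_of_ne (by omega)]; exact h2 t h
    · intro h
      refine ⟨by simpa using h (n + 1) le_rfl, fun t ht => ?_⟩
      have := h t (by omega)
      rwa [Function.update_of_ne (by omega)] at this
  rw [hset, hμ, hμ, ← ENNReal.ofReal_mul (hK _ _)]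
  congr 1
  rw [Finset.prod_Icc_succ_top (by omega), Function.update_of_ne (by omega)]
  have : ∏ t ∈ Finset.Icc 1 n, barK N ρ p (Function.update x (n + 1) j (t - 1))
        (Function.update x (n + 1) j t)
      = ∏ t ∈ Finset.Icc 1 n, barK N ρ p (x (t - 1)) (x t) := by
    refine Finset.prod_congr rfl fun t ht => ?_
    rw [Finset.mem_Icc] at ht
    rw [Function.update_of_ne (by omega), Function.update_of_ne (by omega)]
  rw [this, Function.update_self, Nat.add_sub_cancel, Function.update_of_ne (by omega)]
  ring

lemma bar_step [IsProbabilityMeasure μ]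
    (hK : ∀ i j, 0 ≤ barK N ρ p i j)
    (hμ : ∀ (n : ℕ) (x : ℕ → ℕ),
      μ {ω | ∀ t ≤ n, ω t = x t} =
        ENNReal.ofReal (binomPMF N p (x 0) *
          ∏ t ∈ Finset.Icc 1 n, barK N ρ p (x (t - 1)) (x t)))
    (n : ℕ) (G : (ℕ → ℕ) → ENNReal) (hG : ∀ ω ω', (∀ t ≤ n, ω t = ω' t) → G ω = G ω')
    (H : ℕ → ℕ → ENNReal) (c : ENNReal)
    (hc : ∀ i ≤ N, ∑' j, H i j * ENNReal.ofReal (barK N ρ p i j) ≤ c) :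
    ∫⁻ ω, G ω * H (ω n) (ω (n + 1)) ∂μ ≤ c * ∫⁻ ω, G ω ∂μ := by
  -- extend a finite path by zeros
  let ext : (Fin (n + 1) → ℕ) → (ℕ → ℕ) := fun y t => if h : t < n + 1 then y ⟨t, h⟩ else 0
  let cyl : (Fin (n + 1) → ℕ) → Set (ℕ → ℕ) := fun y => {ω | ∀ t ≤ n, ω t = ext y t}
  have hmeas : ∀ y, MeasurableSet (cyl y) := by
    intro y
    have : cyl y = ⋂ t, ⋂ (_ : t ≤ n), {ω : ℕ → ℕ | ω t = ext y t} := by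
      ext ω; simp [cyl]
    rw [this]
    exact MeasurableSet.iInter fun t => MeasurableSet.iInter fun _ =>
      measurableSet_eq_fun (measurable_pi_apply t) measurable_const
  have hU : ⋃ y, cyl y = Set.univ := by
    refine Set.eq_univ_of_forall fun ω => Set.mem_iUnion.mpr ⟨fun t => ω t, fun t ht => ?_⟩
    simp [ext]
    omega
  have hD : Pairwise (Function.onFun Disjoint cyl) := by
    intro y y' hne
    rw [Function.onFun, Set.disjoint_left]
    intro ω h h'
    apply hne
    funext t
    have h1 := h t.1 (Nat.lt_succ_iff.mp t.2)
    have h2 := h' t.1 (Nat.lt_succ_iff.mp t.2)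
    have h3 := h1.symm.trans h2
    have h4 : (t : ℕ) < n + 1 := t.2
    simpa only [ext, dif_pos h4] using h3
  have hdec : ∀ F : (ℕ → ℕ) → ENNReal, ∫⁻ ω, F ω ∂μ = ∑' y, ∫⁻ ω in cyl y, F ω ∂μ := by
    intro F
    rw [← lintegral_iUnion hmeas hD, hU, Measure.restrict_univ]
  rw [hdec, hdec, ← ENNReal.tsum_mul_left]
  refine ENNReal.tsum_le_tsum fun y => ?_
  have e1 : ∫⁻ ω in cyl y, G ω ∂μ = G (ext y) * μ (cyl y) := by
    rw [setLIntegral_congr_fun (g := fun _ => G (ext y)) (hmeas y) (fun ω hω => hG _ _ hω)]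
    simp
  have e2 : ∫⁻ ω in cyl y, G ω * H (ω n) (ω (n + 1)) ∂μ
      = G (ext y) * ∑' j, H (ext y n) j * μ ({ω | ω (n + 1) = j} ∩ cyl y) := by
    rw [setLIntegral_congr_fun (g := fun ω => G (ext y) * H (ext y n) (ω (n + 1))) (hmeas y)
      (fun ω hω => by
        change G ω * H (ω n) (ω (n + 1)) = _
        rw [hG _ _ hω, hω n le_rfl])]
    have hm : Measurable (fun ω : ℕ → ℕ => ω (n + 1)) := measurable_pi_apply _
    have hm2 : Measurable (H (ext y n)) := measurable_of_countable _
    have hm3 : Measurable (fun ω : ℕ → ℕ => H (ext y n) (ω (n + 1))) := hm2.comp hm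
    rw [lintegral_const_mul _ hm3]
    congr 1
    rw [← lintegral_map (f := H (ext y n)) hm2 hm, lintegral_countable']
    refine tsum_congr fun j => ?_
    rw [Measure.map_apply hm (measurableSet_singleton j), Measure.restrict_apply
      (hm (measurableSet_singleton j))]
    rfl
  rw [e1, e2]
  by_cases hy : N < ext y n
  · have hz : μ (cyl y) = 0 := by
      change μ {ω | ∀ t ≤ n, ω t = ext y t} = 0
      rw [hμ, bar_path_zero n (ext y) hy, ENNReal.ofReal_zero]
    have : ∀ j, μ ({ω | ω (n + 1) = j} ∩ cyl y) = 0 := fun j =>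
      measure_mono_null Set.inter_subset_right hz
    simp [this]
  · have : ∀ j, μ ({ω | ω (n + 1) = j} ∩ cyl y)
        = ENNReal.ofReal (barK N ρ p (ext y n) j) * μ (cyl y) :=
      fun j => bar_cyl_step hK hμ n (ext y) j
    simp only [this, ← mul_assoc, ENNReal.tsum_mul_right]
    have hc' := hc (ext y n) (not_lt.mp hy)
    calc _ ≤ G (ext y) * (c * μ (cyl y)) := by rw [← mul_assoc]; gcongr
      _ = _ := by ring

lemma bar_ae_le [IsProbabilityMeasure μ]
    (hK : ∀ i j, 0 ≤ barK N ρ p i j)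
    (hμ : ∀ (n : ℕ) (x : ℕ → ℕ),
      μ {ω | ∀ t ≤ n, ω t = x t} =
        ENNReal.ofReal (binomPMF N p (x 0) *
          ∏ t ∈ Finset.Icc 1 n, barK N ρ p (x (t - 1)) (x t))) :
    ∀ᵐ ω ∂μ, ∀ t, ω t ≤ N := by
  rw [ae_all_iff]
  intro t
  rcases t with _ | n
  · have : ∀ i : ℕ, ∀ᵐ ω ∂μ, N < i → ω 0 ≠ i := by
      intro i
      by_cases hi : N < i
      · have h := hμ 0 (fun _ => i)
        rw [bar_path_zero (N := N) 0 (fun _ => i) hi, ENNReal.ofReal_zero] at h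
        rw [ae_iff]
        refine measure_mono_null (fun ω hω => ?_) h
        simp at hω
        intro t ht
        obtain rfl : t = 0 := by omega
        exact hω.2
      · exact Eventually.of_forall fun ω h => absurd h hi
    filter_upwards [ae_all_iff.mpr this] with ω hω
    by_contra h
    exact hω (ω 0) (by omega) rfl
  · have h := bar_step hK hμ n (fun _ => 1) (fun _ _ _ => rfl)
      (fun _ j => if N < j then 1 else 0) 0 (fun i hi => by
        simp only [nonpos_iff_eq_zero, ENNReal.tsum_eq_zero]
        intro j
        by_cases hj : N < j
        · rw [barK_zero _ _ hi hj]; simp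
        · simp [hj])
    have hm2 : Measurable (fun j : ℕ => if N < j then (1 : ENNReal) else 0) :=
      measurable_of_countable _
    simp only [one_mul, zero_mul, nonpos_iff_eq_zero] at h
    have hm3 : Measurable (fun ω : ℕ → ℕ => if N < ω (n + 1) then (1 : ENNReal) else 0) :=
      hm2.comp (measurable_pi_apply (n + 1))
    rw [lintegral_eq_zero_iff hm3] at h
    filter_upwards [h] with ω hω
    by_contra hcon
    simp [show N < ω (n + 1) by omega] at hω

lemma bar_exp_bound [IsProbabilityMeasure μ]
    (hK : ∀ i j, 0 ≤ barK N ρ p i j)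
    (hμ : ∀ (n : ℕ) (x : ℕ → ℕ),
      μ {ω | ∀ t ≤ n, ω t = x t} =
        ENNReal.ofReal (binomPMF N p (x 0) *
          ∏ t ∈ Finset.Icc 1 n, barK N ρ p (x (t - 1)) (x t)))
    (φ : ℕ → ℕ → ℝ) (B l : ℝ) (hB : ∀ i j, |φ i j| ≤ B) (hl : 0 ≤ l) (hlB : l * B ≤ 1)
    (hφ : ∀ i ≤ N, ∑ j ∈ Finset.range (N + 1), barK N ρ p i j * φ i j = 0) (n : ℕ) :
    ∫⁻ ω, ENNReal.ofReal (Real.exp (l * ∑ t ∈ Finset.Icc 1 n, φ (ω (t - 1)) (ω t))) ∂μ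
      ≤ ENNReal.ofReal (Real.exp (l ^ 2 * B ^ 2)) ^ n := by
  induction n with
  | zero => simp
  | succ n ih =>
    have h := bar_step hK hμ n
      (fun ω => ENNReal.ofReal (Real.exp (l * ∑ t ∈ Finset.Icc 1 n, φ (ω (t - 1)) (ω t))))
      (fun ω ω' h => by
        congr 3
        refine Finset.sum_congr rfl fun t ht => ?_
        rw [Finset.mem_Icc] at ht
        rw [h t ht.2, h (t - 1) (by omega)])
      (fun i j => ENNReal.ofReal (Real.exp (l * φ i j)))
      (ENNReal.ofReal (Real.exp (l ^ 2 * B ^ 2)))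
      (fun i hi => by
        rw [tsum_eq_sum (s := Finset.range (N + 1))]
        · rw [Finset.sum_congr rfl fun j _ => (ENNReal.ofReal_mul (Real.exp_pos _).le).symm,
            ← ENNReal.ofReal_sum_of_nonneg
              (fun j _ => mul_nonneg (Real.exp_pos _).le (hK _ _))]
          refine ENNReal.ofReal_le_ofReal ?_
          have hb : ∀ j ∈ Finset.range (N + 1), Real.exp (l * φ i j) * barK N ρ p i j
              ≤ (1 + l ^ 2 * B ^ 2) * barK N ρ p i j + l * (barK N ρ p i j * φ i j) := by
            intro j _
            have h1 : |l * φ i j| ≤ l * B := by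
              rw [abs_mul, abs_of_nonneg hl]
              exact mul_le_mul_of_nonneg_left (hB i j) hl
            have h2 := Real.abs_exp_sub_one_sub_id_le (h1.trans hlB)
            have h3 := (abs_le.mp h2).2
            have h4 : (l * φ i j) ^ 2 ≤ (l * B) ^ 2 :=
              sq_le_sq' (abs_le.mp h1).1 (abs_le.mp h1).2
            have h5 : Real.exp (l * φ i j) ≤ 1 + l ^ 2 * B ^ 2 + l * φ i j := by
              nlinarith
            have := mul_le_mul_of_nonneg_right h5 (hK i j)
            linarith
          refine (Finset.sum_le_sum hb).trans ?_
          rw [Finset.sum_add_distrib, ← Finset.mul_sum, ← Finset.mul_sum, hφ i hi,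
            (barK_mom N ρ p i hi).1]
          have := Real.add_one_le_exp (l ^ 2 * B ^ 2)
          linarith
        · intro j hj
          rw [barK_zero i j hi (by simpa using hj)]; simp)
    have e : ∀ ω : ℕ → ℕ,
        ENNReal.ofReal (Real.exp (l * ∑ t ∈ Finset.Icc 1 (n + 1), φ (ω (t - 1)) (ω t)))
        = ENNReal.ofReal (Real.exp (l * ∑ t ∈ Finset.Icc 1 n, φ (ω (t - 1)) (ω t)))
          * ENNReal.ofReal (Real.exp (l * φ (ω n) (ω (n + 1)))) := by
      intro ω
      rw [Finset.sum_Icc_succ_top (by omega), mul_add, Real.exp_add,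
        ENNReal.ofReal_mul (Real.exp_pos _).le, Nat.add_sub_cancel]
    rw [lintegral_congr e, pow_succ']
    exact h.trans (by gcongr)

lemma bar_upper [IsProbabilityMeasure μ]
    (hK : ∀ i j, 0 ≤ barK N ρ p i j)
    (hμ : ∀ (n : ℕ) (x : ℕ → ℕ),
      μ {ω | ∀ t ≤ n, ω t = x t} =
        ENNReal.ofReal (binomPMF N p (x 0) *
          ∏ t ∈ Finset.Icc 1 n, barK N ρ p (x (t - 1)) (x t)))
    (φ : ℕ → ℕ → ℝ) (B : ℝ) (hB1 : 1 ≤ B) (hB : ∀ i j, |φ i j| ≤ B)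
    (hφ : ∀ i ≤ N, ∑ j ∈ Finset.range (N + 1), barK N ρ p i j * φ i j = 0)
    (e : ℝ) (he : 0 < e) (he1 : e ≤ 1) :
    ∀ᵐ ω ∂μ, ∀ᶠ n : ℕ in atTop, ∑ t ∈ Finset.Icc 1 n, φ (ω (t - 1)) (ω t) < e * n := by
  set l : ℝ := e / (2 * B ^ 2) with hl
  have hB0 : 0 < B := by linarith
  have hl0 : 0 < l := by positivity
  have hlB2 : l * B ^ 2 = e / 2 := by rw [hl]; field_simp
  have hlB : l * B ≤ 1 := by nlinarith [mul_pos hl0 hB0]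
  set r : ℝ := Real.exp (l ^ 2 * B ^ 2 - l * e) with hr
  have hr1 : r < 1 := by
    rw [hr, Real.exp_lt_one_iff]
    nlinarith [mul_pos hl0 he]
  let F : ℕ → (ℕ → ℕ) → ENNReal := fun n ω =>
    ENNReal.ofReal (Real.exp (l * ∑ t ∈ Finset.Icc 1 n, φ (ω (t - 1)) (ω t)))
      * ENNReal.ofReal (Real.exp (-(l * e))) ^ n
  have hFm0 : ∀ n, Measurable fun ω : ℕ → ℕ =>
      ENNReal.ofReal (Real.exp (l * ∑ t ∈ Finset.Icc 1 n, φ (ω (t - 1)) (ω t))) := by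
    intro n
    refine ENNReal.measurable_ofReal.comp (Real.measurable_exp.comp
      (Measurable.const_mul (Finset.measurable_sum _ fun t _ => ?_) l))
    have : Measurable (fun q : ℕ × ℕ => φ q.1 q.2) := measurable_of_countable _
    have h2 : Measurable (fun ω : ℕ → ℕ => (ω (t - 1), ω t)) :=
      (measurable_pi_apply (t - 1)).prodMk (measurable_pi_apply t)
    exact this.comp h2
  have hFm : ∀ n, Measurable (F n) := fun n => (hFm0 n).mul_const _
  have hFi : ∀ n, ∫⁻ ω, F n ω ∂μ ≤ ENNReal.ofReal r ^ n := by
    intro n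
    rw [lintegral_mul_const _ (hFm0 n)]
    refine (mul_le_mul_left (bar_exp_bound hK hμ φ B l hB hl0.le hlB hφ n) _).trans ?_
    rw [← mul_pow, ← ENNReal.ofReal_mul (Real.exp_pos _).le, ← Real.exp_add, hr,
      sub_eq_add_neg]
  have hsum : ∫⁻ ω, ∑' n, F n ω ∂μ ≠ ⊤ := by
    rw [lintegral_tsum fun n => (hFm n).aemeasurable]
    refine ne_top_of_le_ne_top ?_ (ENNReal.tsum_le_tsum hFi)
    rw [ENNReal.tsum_geometric]
    refine ENNReal.inv_ne_top.mpr ?_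
    rw [Ne, tsub_eq_zero_iff_le, not_le]
    exact ENNReal.ofReal_lt_one.mpr hr1
  have hfin := ae_lt_top (Measurable.tsum hFm) hsum
  filter_upwards [hfin] with ω hω
  have ht := ENNReal.tendsto_atTop_zero_of_tsum_ne_top hω.ne
  have hev := ht.eventually (gt_mem_nhds (show (0 : ENNReal) < 1 by simp))
  filter_upwards [hev] with n hn
  simp only [F] at hn
  rw [← ENNReal.ofReal_pow (Real.exp_pos _).le, ← ENNReal.ofReal_mul (Real.exp_pos _).le,
    ENNReal.ofReal_lt_one, ← Real.exp_nat_mul, ← Real.exp_add, Real.exp_lt_one_iff] at hn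
  have : l * (∑ t ∈ Finset.Icc 1 n, φ (ω (t - 1)) (ω t) - e * n) < 0 := by linarith
  have := (pos_iff_neg_of_mul_neg this).mp hl0
  linarith

lemma bar_lln [IsProbabilityMeasure μ]
    (hK : ∀ i j, 0 ≤ barK N ρ p i j)
    (hμ : ∀ (n : ℕ) (x : ℕ → ℕ),
      μ {ω | ∀ t ≤ n, ω t = x t} =
        ENNReal.ofReal (binomPMF N p (x 0) *
          ∏ t ∈ Finset.Icc 1 n, barK N ρ p (x (t - 1)) (x t)))
    (φ : ℕ → ℕ → ℝ) (B : ℝ) (hB1 : 1 ≤ B) (hB : ∀ i j, |φ i j| ≤ B)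
    (hφ : ∀ i ≤ N, ∑ j ∈ Finset.range (N + 1), barK N ρ p i j * φ i j = 0) :
    ∀ᵐ ω ∂μ, Tendsto (fun n : ℕ => (1 / (n : ℝ)) * ∑ t ∈ Finset.Icc 1 n, φ (ω (t - 1)) (ω t))
      atTop (nhds 0) := by
  have hk : ∀ k : ℕ, (0 : ℝ) < 1 / ((k : ℝ) + 1) ∧ (1 : ℝ) / ((k : ℝ) + 1) ≤ 1 := by
    intro k
    refine ⟨by positivity, ?_⟩
    rw [div_le_one (by positivity)]
    have : (0 : ℝ) ≤ k := by positivity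
    linarith
  have h1 := ae_all_iff.mpr fun k : ℕ =>
    bar_upper hK hμ φ B hB1 hB hφ (1 / ((k : ℝ) + 1)) (hk k).1 (hk k).2
  have h2 := ae_all_iff.mpr fun k : ℕ =>
    bar_upper hK hμ (fun i j => -φ i j) B hB1 (fun i j => by rw [abs_neg]; exact hB i j)
      (fun i hi => by simp [hφ i hi]) (1 / ((k : ℝ) + 1)) (hk k).1 (hk k).2
  filter_upwards [h1, h2] with ω hω1 hω2
  rw [Metric.tendsto_atTop']
  intro e he
  obtain ⟨k, hke⟩ := exists_nat_one_div_lt he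
  obtain ⟨n0, hn0⟩ := eventually_atTop.mp ((hω1 k).and (hω2 k))
  refine ⟨n0, fun n hn => ?_⟩
  obtain ⟨a1, a2⟩ := hn0 n hn.le
  rw [Finset.sum_neg_distrib] at a2
  have hnpos : (0 : ℝ) < n := by exact_mod_cast (by omega : 0 < n)
  rw [Real.dist_eq, sub_zero, abs_mul, abs_of_pos (by positivity), one_div,
    inv_mul_lt_iff₀ hnpos]
  have : |∑ t ∈ Finset.Icc 1 n, φ (ω (t - 1)) (ω t)| < 1 / ((k : ℝ) + 1) * n :=
    abs_lt.mpr ⟨by linarith, a1⟩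
  nlinarith

end markov

/-! ### Empirical measures -/

/-- Empirical occupation frequency. -/
def empL (ω : ℕ → ℕ) (n i : ℕ) : ℝ :=
  (1 / (n : ℝ)) * ∑ t ∈ Finset.Icc 1 n, (if ω (t - 1) = i then (1 : ℝ) else 0)

/-- Empirical transition frequency. -/
def empC (ω : ℕ → ℕ) (n i j : ℕ) : ℝ :=
  (1 / (n : ℝ)) * ∑ t ∈ Finset.Icc 1 n,
    (if ω (t - 1) = i then (if ω t = j then (1 : ℝ) else 0) else 0)

lemma empL_sum (N : ℕ) (ω : ℕ → ℕ) (hω : ∀ t, ω t ≤ N) (n : ℕ) (hn : 1 ≤ n) :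
    ∑ i ∈ Finset.range (N + 1), empL ω n i = 1 := by
  unfold empL
  rw [← Finset.mul_sum, Finset.sum_comm]
  have : ∀ t ∈ Finset.Icc 1 n, ∑ i ∈ Finset.range (N + 1),
      (if ω (t - 1) = i then (1 : ℝ) else 0) = 1 := by
    intro t _
    rw [Finset.sum_ite_eq, if_pos (by simpa [Nat.lt_succ_iff] using hω (t - 1))]
  rw [Finset.sum_congr rfl this]
  have : (n : ℝ) ≠ 0 := by positivity
  simp [this]

lemma empC_sum (N : ℕ) (ω : ℕ → ℕ) (hω : ∀ t, ω t ≤ N) (n j : ℕ) :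
    ∑ i ∈ Finset.range (N + 1), empC ω n i j
      = (1 / (n : ℝ)) * ∑ t ∈ Finset.Icc 1 n, (if ω t = j then (1 : ℝ) else 0) := by
  unfold empC
  rw [← Finset.mul_sum, Finset.sum_comm]
  congr 1
  refine Finset.sum_congr rfl fun t _ => ?_
  rw [Finset.sum_ite_eq, if_pos (by simpa [Nat.lt_succ_iff] using hω (t - 1))]

lemma emp_avg (N : ℕ) (ω : ℕ → ℕ) (hω : ∀ t, ω t ≤ N) (n : ℕ) (f : ℕ → ℕ → ℝ) :
    (1 / (n : ℝ)) * ∑ t ∈ Finset.Icc 1 n, f (ω (t - 1)) (ω t)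
      = ∑ i ∈ Finset.range (N + 1), ∑ j ∈ Finset.range (N + 1), empC ω n i j * f i j := by
  unfold empC
  have h : ∀ t ∈ Finset.Icc 1 n, f (ω (t - 1)) (ω t)
      = ∑ i ∈ Finset.range (N + 1), ∑ j ∈ Finset.range (N + 1),
        (if ω (t - 1) = i then (if ω t = j then (1 : ℝ) else 0) else 0) * f i j := by
    intro t _
    rw [Finset.sum_eq_single_of_mem (ω (t - 1)) (by simpa [Nat.lt_succ_iff] using hω (t - 1))
      (fun i _ hi => by simp [hi.symm]),
      Finset.sum_eq_single_of_mem (ω t) (by simpa [Nat.lt_succ_iff] using hω t)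
      (fun i _ hi => by simp [hi.symm])]
    simp
  rw [Finset.sum_congr rfl h, Finset.sum_comm, Finset.mul_sum]
  refine Finset.sum_congr rfl fun i _ => ?_
  rw [Finset.sum_comm, Finset.mul_sum]
  refine Finset.sum_congr rfl fun j _ => ?_
  rw [mul_assoc, Finset.sum_mul]

lemma bar_telescope (f : ℕ → ℝ) (n : ℕ) :
    ∑ t ∈ Finset.Icc 1 n, f (t - 1) - ∑ t ∈ Finset.Icc 1 n, f t = f 0 - f n := by
  induction n with
  | zero => simp
  | succ n ih =>
    rw [Finset.sum_Icc_succ_top (by omega), Finset.sum_Icc_succ_top (by omega),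
      Nat.add_sub_cancel]
    linarith

lemma empL_tendsto {N : ℕ} {p ρ : ℝ} (hpos : ∀ i ≤ N, ∀ j ≤ N, 0 < barK N ρ p i j)
    (ω : ℕ → ℕ) (hω : ∀ t, ω t ≤ N)
    (h : ∀ i ≤ N, ∀ j ≤ N, Tendsto (fun n => empC ω n i j - barK N ρ p i j * empL ω n i)
      atTop (nhds 0)) :
    ∀ j ≤ N, Tendsto (fun n => empL ω n j) atTop (nhds (binomPMF N p j)) := by
  set R := Finset.range (N + 1) with hR
  have hmem : ∀ i, i ∈ R ↔ i ≤ N := by intro i; simp [hR, Nat.lt_succ_iff]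
  -- minorization constant
  obtain ⟨e, he0, he⟩ : ∃ e : ℝ, 0 < e ∧ ∀ i ≤ N, ∀ j ≤ N, e ≤ barK N ρ p i j := by
    have hne : (R ×ˢ R).Nonempty := ⟨(0, 0), by simp [hR]⟩
    obtain ⟨q, hq, hmin⟩ := Finset.exists_min_image (R ×ˢ R)
      (fun q => barK N ρ p q.1 q.2) hne
    rw [Finset.mem_product, hmem, hmem] at hq
    exact ⟨_, hpos q.1 hq.1 q.2 hq.2, fun i hi j hj =>
      hmin (i, j) (by rw [Finset.mem_product, hmem, hmem]; exact ⟨hi, hj⟩)⟩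
  let D : ℕ → ℕ → ℝ := fun n i => empL ω n i - binomPMF N p i
  let E : ℕ → ℕ → ℝ := fun n j => D n j - ∑ i ∈ R, D n i * barK N ρ p i j
  have hE : ∀ j ∈ R, Tendsto (fun n => E n j) atTop (nhds 0) := by
    intro j hj
    have e1 : ∀ n, E n j = (1 / (n : ℝ)) *
        ((if ω 0 = j then (1 : ℝ) else 0) - (if ω n = j then (1 : ℝ) else 0))
        + ∑ i ∈ R, (empC ω n i j - barK N ρ p i j * empL ω n i) := by
      intro n
      have hs := bar_stationary N ρ p j
      have hc := empC_sum N ω hω n j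
      have ht := bar_telescope (fun t => if ω t = j then (1 : ℝ) else 0) n
      simp only [E, D, sub_mul, Finset.sum_sub_distrib]
      rw [hs, hc, ← ht]
      unfold empL
      have : ∀ i ∈ R, barK N ρ p i j * (1 / (n : ℝ) * ∑ t ∈ Finset.Icc 1 n,
          (if ω (t - 1) = i then (1 : ℝ) else 0)) = (1 / (n : ℝ) * ∑ t ∈ Finset.Icc 1 n,
          (if ω (t - 1) = i then (1 : ℝ) else 0)) * barK N ρ p i j := fun i _ => mul_comm _ _
      rw [Finset.sum_congr rfl this]
      ring
    have t1 : Tendsto (fun n : ℕ => (1 / (n : ℝ)) *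
        ((if ω 0 = j then (1 : ℝ) else 0) - (if ω n = j then (1 : ℝ) else 0)))
        atTop (nhds 0) := by
      refine squeeze_zero_norm (fun n => ?_) tendsto_one_div_atTop_nhds_zero_nat
      rw [norm_mul]
      have a1 : ‖(1 / (n : ℝ))‖ = 1 / (n : ℝ) := by
        rw [Real.norm_eq_abs, abs_of_nonneg (by positivity)]
      rw [a1]
      refine mul_le_of_le_one_right (by positivity) ?_
      split_ifs <;> simp
    have t2 : Tendsto (fun n : ℕ => ∑ i ∈ R, (empC ω n i j - barK N ρ p i j * empL ω n i))
        atTop (nhds (∑ i ∈ R, (0 : ℝ))) :=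
      tendsto_finsetSum _ fun i hi => h i ((hmem i).mp hi) j ((hmem j).mp hj)
    simp only [e1]
    simpa using t1.add t2
  have hEs : Tendsto (fun n => ∑ j ∈ R, |E n j|) atTop (nhds 0) := by
    have := tendsto_finsetSum R fun j hj => (hE j hj).abs
    simpa using this
  have hbound : ∀ n, 1 ≤ n → e * ∑ j ∈ R, |D n j| ≤ ∑ j ∈ R, |E n j| := by
    intro n hn
    have hsum0 : ∑ i ∈ R, D n i = 0 := by
      simp only [D, Finset.sum_sub_distrib]
      rw [empL_sum N ω hω n hn, (binom_mom N p).1, sub_self]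
    have h1 : ∀ j ∈ R, |D n j| ≤ |E n j| + ∑ i ∈ R, |D n i| * (barK N ρ p i j - e) := by
      intro j hj
      have q : D n j = E n j + ∑ i ∈ R, D n i * (barK N ρ p i j - e) := by
        simp only [mul_sub, Finset.sum_sub_distrib, ← Finset.sum_mul, hsum0, E]
        ring
      calc |D n j| = |E n j + ∑ i ∈ R, D n i * (barK N ρ p i j - e)| := by rw [← q]
        _ ≤ |E n j| + |∑ i ∈ R, D n i * (barK N ρ p i j - e)| := abs_add_le _ _
        _ ≤ _ := by
          gcongr
          refine (Finset.abs_sum_le_sum_abs _ _).trans (Finset.sum_le_sum fun i hi => ?_)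
          rw [abs_mul, abs_of_nonneg (a := barK N ρ p i j - e)]
          linarith [he i ((hmem i).mp hi) j ((hmem j).mp hj)]
    have h2 := Finset.sum_le_sum h1
    rw [Finset.sum_add_distrib, Finset.sum_comm (s := R) (t := R)] at h2
    have h3 : ∀ i ∈ R, ∑ j ∈ R, |D n i| * (barK N ρ p i j - e)
        = |D n i| * (1 - (N + 1) * e) := by
      intro i hi
      rw [← Finset.mul_sum, Finset.sum_sub_distrib, (barK_mom N ρ p i ((hmem i).mp hi)).1]
      simp [hR]
    rw [Finset.sum_congr rfl h3, ← Finset.sum_mul] at h2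
    have h4 : 0 ≤ ∑ j ∈ R, |D n j| := Finset.sum_nonneg fun _ _ => abs_nonneg _
    have h5 : 0 ≤ (N : ℝ) * (e * ∑ j ∈ R, |D n j|) := by positivity
    nlinarith
  intro j hj
  have hD : Tendsto (fun n => D n j) atTop (nhds 0) := by
    have hz : Tendsto (fun n => e⁻¹ * ∑ j ∈ R, |E n j|) atTop (nhds 0) := by
      simpa using hEs.const_mul e⁻¹
    refine squeeze_zero_norm' ?_ hz
    filter_upwards [eventually_ge_atTop 1] with n hn
    have h1 : |D n j| ≤ ∑ j ∈ R, |D n j| :=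
      Finset.single_le_sum (f := fun j => |D n j|) (fun _ _ => abs_nonneg _) ((hmem j).mpr hj)
    rw [Real.norm_eq_abs, le_inv_mul_iff₀ he0]
    exact (mul_le_mul_of_nonneg_left h1 he0.le).trans (hbound n hn)
  have := hD.add_const (binomPMF N p j)
  simpa [D] using this

lemma bar_ergodic {N : ℕ} {p ρ : ℝ} (h : 0 < p * (1 - ρ) ∧ 0 < 1 - p * (1 - ρ) ∧
    0 < p * (1 - ρ) + ρ ∧ 0 < 1 - (p * (1 - ρ) + ρ))
    (μ : Measure (ℕ → ℕ)) [IsProbabilityMeasure μ]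
    (hμ : ∀ (n : ℕ) (x : ℕ → ℕ),
      μ {ω | ∀ t ≤ n, ω t = x t} =
        ENNReal.ofReal (binomPMF N p (x 0) *
          ∏ t ∈ Finset.Icc 1 n, barK N ρ p (x (t - 1)) (x t))) :
    ∀ᵐ ω ∂μ, ∀ (f : ℕ → ℕ → ℕ → ℝ) (g : ℕ → ℕ → ℝ),
      (∀ i j, Tendsto (fun n => f n i j) atTop (nhds (g i j))) →
      Tendsto (fun n : ℕ => (1 / (n : ℝ)) * ∑ t ∈ Finset.Icc 1 n, f n (ω (t - 1)) (ω t)) atTop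
        (nhds (∑ i ∈ Finset.range (N + 1), binomPMF N p i *
          ∑ j ∈ Finset.range (N + 1), barK N ρ p i j * g i j)) := by
  have hK := barK_nonneg (N := N) h
  have hC : ∀ᵐ ω ∂μ, ∀ i j : ℕ, i ≤ N → j ≤ N →
      Tendsto (fun n => empC ω n i j - barK N ρ p i j * empL ω n i) atTop (nhds 0) := by
    rw [ae_all_iff]; intro i
    rw [ae_all_iff]; intro j
    by_cases hi : i ≤ N
    swap
    · exact Eventually.of_forall fun ω h => absurd h hi
    by_cases hj : j ≤ N
    swap
    · exact Eventually.of_forall fun ω _ h => absurd h hj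
    have hl := bar_lln hK hμ
      (fun a b => if a = i then (if b = j then (1 : ℝ) else 0) - barK N ρ p i j else 0)
      (1 + barK N ρ p i j) (by linarith [hK i j]) (fun a b => by
        have := hK i j
        split_ifs <;> rw [abs_le] <;> constructor <;> linarith)
      (fun a ha => by
        by_cases hai : a = i
        · subst hai
          simp only [if_true, mul_sub, Finset.sum_sub_distrib, ← Finset.sum_mul]
          rw [(barK_mom N ρ p a ha).1]
          simp only [mul_ite, mul_one, mul_zero, Finset.sum_ite_eq']
          rw [if_pos (by simpa [Nat.lt_succ_iff] using hj)]
          ring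
        · simp [hai])
    filter_upwards [hl] with ω hω _ _
    refine hω.congr fun n => ?_
    unfold empC empL
    rw [mul_left_comm, ← mul_sub, Finset.mul_sum (a := barK N ρ p i j),
      ← Finset.sum_sub_distrib]
    congr 1
    refine Finset.sum_congr rfl fun t _ => ?_
    by_cases hh : ω (t - 1) = i <;> simp [hh]
  filter_upwards [hC, bar_ae_le hK hμ] with ω hω hb f g hfg
  have hL := empL_tendsto (fun i hi j hj => barK_pos h i j hi hj) ω hb
    (fun i hi j hj => hω i j hi hj)
  have hCl : ∀ i ≤ N, ∀ j ≤ N, Tendsto (fun n => empC ω n i j) atTop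
      (nhds (binomPMF N p i * barK N ρ p i j)) := by
    intro i hi j hj
    have := (hω i j hi hj).add ((hL i hi).const_mul (barK N ρ p i j))
    simpa [mul_comm] using this
  simp only [emp_avg N ω hb, Finset.mul_sum, ← mul_assoc]
  refine tendsto_finsetSum _ fun i hi => tendsto_finsetSum _ fun j hj => ?_
  simp only [Finset.mem_range, Nat.lt_succ_iff] at hi hj
  exact (hCl i hi j hj).mul (hfg i j)

lemma bar_pi_lin (N : ℕ) (p a b c : ℝ) :
    ∑ i ∈ Finset.range (N + 1), binomPMF N p i * (a * (i : ℝ) ^ 2 + b * i + c)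
      = a * (N * p * (1 - p) + (N * p) ^ 2) + b * (N * p) + c := by
  obtain ⟨h0, h1, h2⟩ := binom_mom N p
  have : ∀ i ∈ Finset.range (N + 1), binomPMF N p i * (a * (i : ℝ) ^ 2 + b * i + c)
      = a * (binomPMF N p i * (i : ℝ) ^ 2) + b * (binomPMF N p i * i) + c * binomPMF N p i :=
    fun i _ => by ring
  rw [Finset.sum_congr rfl this, Finset.sum_add_distrib, Finset.sum_add_distrib,
    ← Finset.mul_sum, ← Finset.mul_sum, ← Finset.mul_sum, h0, h1, h2]
  ring

lemma bar_fst (N : ℕ) (ρ p : ℝ) (g : ℕ → ℝ) :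
    ∑ i ∈ Finset.range (N + 1), binomPMF N p i *
      ∑ j ∈ Finset.range (N + 1), barK N ρ p i j * g i
      = ∑ i ∈ Finset.range (N + 1), binomPMF N p i * g i := by
  refine Finset.sum_congr rfl fun i hi => ?_
  rw [← Finset.sum_mul, (barK_mom N ρ p i (by simpa [Nat.lt_succ_iff] using hi)).1, one_mul]

lemma bar_snd (N : ℕ) (ρ p : ℝ) (g : ℕ → ℝ) :
    ∑ i ∈ Finset.range (N + 1), binomPMF N p i *
      ∑ j ∈ Finset.range (N + 1), barK N ρ p i j * (j * g i)
      = ∑ i ∈ Finset.range (N + 1), binomPMF N p i * ((ρ * i + N * p * (1 - ρ)) * g i) := by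
  refine Finset.sum_congr rfl fun i hi => ?_
  simp only [← mul_assoc]
  rw [← Finset.sum_mul, (barK_mom N ρ p i (by simpa [Nat.lt_succ_iff] using hi)).2.1]
  ring

lemma bar_res (N : ℕ) (ρ p : ℝ) (g : ℕ → ℝ) :
    ∑ i ∈ Finset.range (N + 1), binomPMF N p i *
      ∑ j ∈ Finset.range (N + 1), barK N ρ p i j *
        (((j : ℝ) - ρ * i - N * p * (1 - ρ)) ^ 2 * g i)
      = ∑ i ∈ Finset.range (N + 1), binomPMF N p i * (g i * sigmaSq N ρ p i) := by
  refine Finset.sum_congr rfl fun i hi => ?_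
  simp only [← mul_assoc]
  rw [← Finset.sum_mul, (barK_mom N ρ p i (by simpa [Nat.lt_succ_iff] using hi)).2.2]
  ring

/-- **Almost-sure convergence of the empirical matrices.**
μ-almost surely, `V̂_n → diag(N p(1-p), N²(1-ρ)²)` and `Ŵ_n → W_CLS` entrywise. -/
theorem empirical_matrices_converge
    (N : ℕ) (hN : 1 ≤ N) (p ρ : ℝ) (hp0 : 0 < p) (hp1 : p < 1)
    (hρl : max (-(p / (1 - p))) (-((1 - p) / p)) < ρ) (hρu : ρ < 1)
    (μ : Measure (ℕ → ℕ)) [IsProbabilityMeasure μ]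
    (hμ : ∀ (n : ℕ) (x : ℕ → ℕ),
      μ {ω | ∀ t ≤ n, ω t = x t} =
        ENNReal.ofReal (binomPMF N p (x 0) *
          ∏ t ∈ Finset.Icc 1 n, barK N ρ p (x (t - 1)) (x t))) :
    ∀ᵐ ω ∂μ, ∀ a b : Fin 2,
      Tendsto (fun n : ℕ => Vhat N n (xR ω) a b) atTop
        (nhds (!![(N : ℝ) * p * (1 - p), 0; 0, (N : ℝ) ^ 2 * (1 - ρ) ^ 2] a b)) ∧
      Tendsto (fun n : ℕ => What N n (xR ω) a b) atTop (nhds (Wcls N ρ p a b)) := by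
  have hpar := bar_params hp0 hp1 hρl hρu
  filter_upwards [bar_ergodic hpar μ hμ] with ω hω
  have hN0 : (0 : ℝ) < N := by exact_mod_cast hN
  have hc : ∀ f : ℕ → ℕ → ℝ, _ := fun f => hω (fun _ => f) f (fun _ _ => tendsto_const_nhds)
  -- elementary averages
  have ax : Tendsto (fun n : ℕ => (1 / (n : ℝ)) * ∑ t ∈ Finset.Icc 1 n, xR ω (t - 1)) atTop
      (nhds (N * p)) := by
    have h := hc (fun i _ => (i : ℝ))
    rw [bar_fst N ρ p (fun i => (i : ℝ)), (binom_mom N p).2.1] at h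
    exact h
  have ay : Tendsto (fun n : ℕ => (1 / (n : ℝ)) * ∑ t ∈ Finset.Icc 1 n, xR ω t) atTop
      (nhds (N * p)) := by
    have h := hc (fun _ j => (j : ℝ) * 1)
    rw [bar_snd N ρ p (fun _ => 1)] at h
    have e : ∑ i ∈ Finset.range (N + 1), binomPMF N p i * ((ρ * i + N * p * (1 - ρ)) * 1)
        = N * p := by
      have := bar_pi_lin N p 0 ρ (N * p * (1 - ρ))
      simp only [zero_mul, zero_add, mul_one] at this ⊢
      rw [this]; ring
    rw [e] at h
    simpa [xR] using h
  have axx : Tendsto (fun n : ℕ => (1 / (n : ℝ)) * ∑ t ∈ Finset.Icc 1 n, xR ω (t - 1) ^ 2) atTop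
      (nhds (N * p * (1 - p) + (N * p) ^ 2)) := by
    have h := hc (fun i _ => (i : ℝ) ^ 2)
    rw [bar_fst N ρ p (fun i => (i : ℝ) ^ 2), (binom_mom N p).2.2] at h
    exact h
  have axy : Tendsto (fun n : ℕ => (1 / (n : ℝ)) * ∑ t ∈ Finset.Icc 1 n, xR ω t * xR ω (t - 1))
      atTop (nhds (ρ * (N * p * (1 - p)) + (N * p) ^ 2)) := by
    have h := hc (fun i j => (j : ℝ) * (i : ℝ))
    rw [bar_snd N ρ p (fun i => (i : ℝ))] at h
    have e : ∑ i ∈ Finset.range (N + 1), binomPMF N p i * ((ρ * i + N * p * (1 - ρ)) * i)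
        = ρ * (N * p * (1 - p)) + (N * p) ^ 2 := by
      have := bar_pi_lin N p ρ (N * p * (1 - ρ)) 0
      rw [show ρ * (N * p * (1 - p)) + (N * p) ^ 2 = ρ * (N * p * (1 - p) + (N * p) ^ 2)
        + N * p * (1 - ρ) * (N * p) + 0 by ring, ← this]
      exact Finset.sum_congr rfl fun i _ => by ring
    rw [e] at h
    exact h
  have hv : 0 < (N : ℝ) * p * (1 - p) := by
    have : 0 < 1 - p := by linarith
    positivity
  -- consistency of the estimators
  have hrho : Tendsto (fun n => clsRho (xR ω) n) atTop (nhds ρ) := by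
    have h := (axy.sub (ay.mul ax)).div (axx.sub (ax.pow 2)) (by
      rw [add_sub_cancel_right]; exact hv.ne')
    have e : (ρ * (N * p * (1 - p)) + (N * p) ^ 2 - N * p * (N * p)) /
        (N * p * (1 - p) + (N * p) ^ 2 - (N * p) ^ 2) = ρ := by
      rw [add_sub_cancel_right, div_eq_iff hv.ne']; ring
    rw [e] at h
    refine h.congr' ?_
    filter_upwards [eventually_ge_atTop 1] with n hn
    have hn0 : (n : ℝ) ≠ 0 := by positivity
    simp only [Pi.div_apply, clsRho]
    have hnn : (n : ℝ) ^ 2 ≠ 0 := pow_ne_zero 2 hn0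
    rw [← mul_div_mul_left _ _ hnn]
    congr 1 <;> field_simp
  have hone : Tendsto (fun n => 1 - clsRho (xR ω) n) atTop (nhds (1 - ρ)) := hrho.const_sub 1
  have h1ρ : (1 - ρ) ≠ 0 := by linarith
  have hpp : Tendsto (fun n => clsP N (xR ω) n) atTop (nhds p) := by
    have h := (ay.sub (hrho.mul ax)).div (hone.const_mul (N : ℝ)) (mul_ne_zero hN0.ne' h1ρ)
    have e : (N * p - ρ * (N * p)) / (N * (1 - ρ)) = p := by
      rw [div_eq_iff (mul_ne_zero hN0.ne' h1ρ)]; ring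
    rw [e] at h
    refine h.congr' ?_
    filter_upwards [eventually_ge_atTop 1] with n hn
    have hn0 : (n : ℝ) ≠ 0 := by positivity
    simp only [Pi.div_apply, clsP]
    rw [← mul_div_mul_left _ _ hn0]
    congr 1
    · field_simp
    · ring
  have hm : Tendsto (fun n => (N : ℝ) * clsP N (xR ω) n) atTop (nhds (N * p)) :=
    hpp.const_mul _
  have hNr : Tendsto (fun n => (N : ℝ) * (1 - clsRho (xR ω) n)) atTop (nhds (N * (1 - ρ))) :=
    hone.const_mul _
  have hx : ∀ i : ℕ, Tendsto (fun n => (i : ℝ) - N * clsP N (xR ω) n) atTop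
      (nhds ((i : ℝ) - N * p)) := fun i => hm.const_sub _
  have hs : ∀ i j : ℕ, Tendsto (fun n => (j : ℝ) - clsRho (xR ω) n * i
      - N * clsP N (xR ω) n * (1 - clsRho (xR ω) n)) atTop
      (nhds ((j : ℝ) - ρ * i - N * p * (1 - ρ))) := fun i j =>
    ((hrho.mul_const _).const_sub _).sub (hm.mul hone)
  -- entries of V
  have V11 : Tendsto (fun n : ℕ => Vhat N n (xR ω) 0 0) atTop (nhds (N * p * (1 - p))) := by
    have h := hω (fun n i _ => ((i : ℝ) - N * clsP N (xR ω) n) ^ 2)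
      (fun i _ => ((i : ℝ) - N * p) ^ 2) (fun i _ => (hx i).pow 2)
    rw [bar_fst N ρ p (fun i => ((i : ℝ) - N * p) ^ 2)] at h
    have e : ∑ i ∈ Finset.range (N + 1), binomPMF N p i * ((i : ℝ) - N * p) ^ 2
        = N * p * (1 - p) := by
      have := bar_pi_lin N p 1 (-2 * (N * p)) ((N * p) ^ 2)
      rw [show (N : ℝ) * p * (1 - p) = 1 * (N * p * (1 - p) + (N * p) ^ 2)
        + (-2 * (N * p)) * (N * p) + (N * p) ^ 2 by ring, ← this]
      exact Finset.sum_congr rfl fun i _ => by ring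
    rw [e] at h
    exact h
  have V12 : Tendsto (fun n : ℕ => Vhat N n (xR ω) 0 1) atTop (nhds 0) := by
    have h := hω (fun n i _ => ((i : ℝ) - N * clsP N (xR ω) n) * (N * (1 - clsRho (xR ω) n)))
      (fun i _ => ((i : ℝ) - N * p) * (N * (1 - ρ))) (fun i _ => (hx i).mul hNr)
    rw [bar_fst N ρ p (fun i => ((i : ℝ) - N * p) * (N * (1 - ρ)))] at h
    have e : ∑ i ∈ Finset.range (N + 1), binomPMF N p i * (((i : ℝ) - N * p) * (N * (1 - ρ)))
        = 0 := by
      have := bar_pi_lin N p 0 (N * (1 - ρ)) (-(N * p) * (N * (1 - ρ)))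
      rw [show (0 : ℝ) = 0 * (N * p * (1 - p) + (N * p) ^ 2)
        + (N * (1 - ρ)) * (N * p) + (-(N * p) * (N * (1 - ρ))) by ring, ← this]
      exact Finset.sum_congr rfl fun i _ => by ring
    rw [e] at h
    exact h
  have V22 : Tendsto (fun n : ℕ => Vhat N n (xR ω) 1 1) atTop
      (nhds ((N : ℝ) ^ 2 * (1 - ρ) ^ 2)) := (hone.pow 2).const_mul _
  -- entries of W
  have W11 : Tendsto (fun n : ℕ => What N n (xR ω) 0 0) atTop (nhds (Wcls N ρ p 0 0)) := by
    have h := hω (fun n i j => (((j : ℝ) - clsRho (xR ω) n * i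
        - N * clsP N (xR ω) n * (1 - clsRho (xR ω) n)) * ((i : ℝ) - N * clsP N (xR ω) n)) ^ 2)
      (fun i j => (((j : ℝ) - ρ * i - N * p * (1 - ρ)) * ((i : ℝ) - N * p)) ^ 2)
      (fun i j => ((hs i j).mul (hx i)).pow 2)
    have e : ∑ i ∈ Finset.range (N + 1), binomPMF N p i *
        ∑ j ∈ Finset.range (N + 1), barK N ρ p i j *
        (((j : ℝ) - ρ * i - N * p * (1 - ρ)) * ((i : ℝ) - N * p)) ^ 2
        = Wcls N ρ p 0 0 := by
      have := bar_res N ρ p (fun i => ((i : ℝ) - N * p) ^ 2)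
      simp only [mul_pow]
      rw [this]
      simp only [Wcls, Matrix.of_apply, Matrix.cons_val', Matrix.cons_val_zero]
      exact Finset.sum_congr rfl fun i _ => by ring
    rw [e] at h
    exact h
  have W12 : Tendsto (fun n : ℕ => What N n (xR ω) 0 1) atTop (nhds (Wcls N ρ p 0 1)) := by
    have h := hω (fun n i j => ((j : ℝ) - clsRho (xR ω) n * i
        - N * clsP N (xR ω) n * (1 - clsRho (xR ω) n)) ^ 2 * ((i : ℝ) - N * clsP N (xR ω) n)
          * (N * (1 - clsRho (xR ω) n)))
      (fun i j => ((j : ℝ) - ρ * i - N * p * (1 - ρ)) ^ 2 * ((i : ℝ) - N * p) * (N * (1 - ρ)))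
      (fun i j => (((hs i j).pow 2).mul (hx i)).mul hNr)
    have e : ∑ i ∈ Finset.range (N + 1), binomPMF N p i *
        ∑ j ∈ Finset.range (N + 1), barK N ρ p i j *
        (((j : ℝ) - ρ * i - N * p * (1 - ρ)) ^ 2 * ((i : ℝ) - N * p) * (N * (1 - ρ)))
        = Wcls N ρ p 0 1 := by
      have := bar_res N ρ p (fun i => ((i : ℝ) - N * p) * (N * (1 - ρ)))
      simp only [mul_assoc] at this ⊢
      rw [this]
      simp only [Wcls, Matrix.of_apply, Matrix.cons_val', Matrix.cons_val_zero,
        Matrix.cons_val_one, Finset.mul_sum]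
      exact Finset.sum_congr rfl fun i _ => by ring
    rw [e] at h
    exact h
  have W22 : Tendsto (fun n : ℕ => What N n (xR ω) 1 1) atTop (nhds (Wcls N ρ p 1 1)) := by
    have h := hω (fun n i j => (((j : ℝ) - clsRho (xR ω) n * i
        - N * clsP N (xR ω) n * (1 - clsRho (xR ω) n)) * (N * (1 - clsRho (xR ω) n))) ^ 2)
      (fun i j => (((j : ℝ) - ρ * i - N * p * (1 - ρ)) * (N * (1 - ρ))) ^ 2)
      (fun i j => ((hs i j).mul hNr).pow 2)
    have e : ∑ i ∈ Finset.range (N + 1), binomPMF N p i *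
        ∑ j ∈ Finset.range (N + 1), barK N ρ p i j *
        (((j : ℝ) - ρ * i - N * p * (1 - ρ)) * (N * (1 - ρ))) ^ 2
        = Wcls N ρ p 1 1 := by
      have := bar_res N ρ p (fun _ => (N * (1 - ρ)) ^ 2)
      simp only [mul_pow _ ((N : ℝ) * (1 - ρ))]
      rw [this]
      simp only [Wcls, Matrix.of_apply, Matrix.cons_val', Matrix.cons_val_one,
        Matrix.cons_val_fin_one, Finset.mul_sum]
      exact Finset.sum_congr rfl fun i _ => by ring
    rw [e] at h
    exact h
  intro a b
  fin_cases a <;> fin_cases b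
  · exact ⟨V11, W11⟩
  · exact ⟨V12, W12⟩
  · exact ⟨V12, W12⟩
  · exact ⟨V22, W22⟩
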